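/- Let m, n ≥ 2, d ≥ 1, 1 ≤ r ≤ min{m,n}−1, and 0 ≤ a ≤ rd be integers. Then there exists an m×n complex matrix polynomial P of grade d with leading coefficient A_d ≠ 0 (i.e., of degree exactly d) and normal rank exactly r whose first companion form C¹_P is strictly equivalent to the pencil G_a. -/

import Mathlib

open Matrix Finset

namespace MPoly

/-- The space `POL_{d,m×n}` of `m × n` complex matrix polynomials of grade `d`,
identified with the tuple of coefficients `(A_0, …, A_d)`. -/
abbrev Pol (d m n : ℕ) := Fin (d+1) → Matrix (Fin m) (Fin n) ℂ

/-- A matrix pencil `λ A + B` of size `p × q`, identified with the pair `(A, B)`. -/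
abbrev Pencil (p q : ℕ) := Matrix (Fin p) (Fin q) ℂ × Matrix (Fin p) (Fin q) ℂ

/-- The metric on `POL_{d,m×n}`:  `dist(P,P') = (Σ_i ‖A_i − A'_i‖_F²)^(1/2)`. -/
noncomputable def polDist {m n d : ℕ} (P P' : Pol d m n) : ℝ :=
  Real.sqrt (∑ k, ∑ i, ∑ j, ‖P k i j - P' k i j‖ ^ 2)

/-- The Frobenius norm of a matrix polynomial: `‖P‖_F = (Σ_i ‖A_i‖_F²)^(1/2)`. -/
noncomputable def polNorm {m n d : ℕ} (P : Pol d m n) : ℝ :=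
  Real.sqrt (∑ k, ∑ i, ∑ j, ‖P k i j‖ ^ 2)

/-- The metric on pencils: `dist(λA+B, λA'+B') = (‖A−A'‖_F² + ‖B−B'‖_F²)^(1/2)`. -/
noncomputable def penDist {p q : ℕ} (L L' : Pencil p q) : ℝ :=
  Real.sqrt ((∑ i, ∑ j, ‖L.1 i j - L'.1 i j‖ ^ 2) + (∑ i, ∑ j, ‖L.2 i j - L'.2 i j‖ ^ 2))

/-- The `λ`-part `A = diag(A_d, I_n, …, I_n)` of the first companion form. -/
noncomputable def compA (m n d : ℕ) (P : Pol d m n) :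
    Matrix (Fin (m + n*(d-1))) (Fin (n*d)) ℂ := fun i j =>
  if hi : (i : ℕ) < m then
    if hj : (j : ℕ) < n then P (Fin.last d) ⟨i, hi⟩ ⟨j, hj⟩ else 0
  else if (i : ℕ) - m = (j : ℕ) - n ∧ n ≤ (j : ℕ) then 1 else 0

/-- The constant part `B` of the first companion form: first block row
`(A_{d-1}, …, A_0)`, with `−I_n` in block entries `(i+1, i)`. -/
noncomputable def compB (m n d : ℕ) (P : Pol d m n) :
    Matrix (Fin (m + n*(d-1))) (Fin (n*d)) ℂ := fun i j =>
  if hi : (i : ℕ) < m then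
    if hn : 0 < n then
      P ⟨d - 1 - (j : ℕ) / n, Nat.lt_succ_of_le ((Nat.sub_le _ _).trans (Nat.sub_le d 1))⟩ ⟨i, hi⟩ ⟨(j : ℕ) % n, Nat.mod_lt _ hn⟩
    else 0
  else if (j : ℕ) = (i : ℕ) - m then -1 else 0

/-- The first Frobenius companion form `C¹_P` of a matrix polynomial. -/
noncomputable def comp (m n d : ℕ) (P : Pol d m n) : Pencil (m + n*(d-1)) (n*d) :=
  (compA m n d P, compB m n d P)

/-- Strict equivalence of matrix pencils: `Q⁻¹ (λA+B) R = λC+D` for invertible `Q, R`. -/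
def StrictEquiv {p q : ℕ} (L M : Pencil p q) : Prop :=
  ∃ (Q : Matrix (Fin p) (Fin p) ℂ) (R : Matrix (Fin q) (Fin q) ℂ),
    IsUnit Q ∧ IsUnit R ∧ Q⁻¹ * L.1 * R = M.1 ∧ Q⁻¹ * L.2 * R = M.2

/-- The strict equivalence orbit of a pencil. -/
def orbE {p q : ℕ} (L : Pencil p q) : Set (Pencil p q) := {M | StrictEquiv L M}

/-- The generalized Sylvester space `GSYL¹_{d,m×n}` of all first companion forms. -/
def GSYL (m n d : ℕ) : Set (Pencil (m + n*(d-1)) (n*d)) := Set.range (comp m n d)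

/-- A matrix polynomial viewed as a matrix over the field `ℂ(λ)` of rational functions. -/
noncomputable def ratMatrix {m n d : ℕ} (P : Pol d m n) :
    Matrix (Fin m) (Fin n) (RatFunc ℂ) :=
  fun i j => ∑ k : Fin (d+1), RatFunc.C (P k i j) * RatFunc.X ^ (k : ℕ)

/-- The normal rank of a matrix polynomial: its rank over `ℂ(λ)`. -/
noncomputable def nrank {m n d : ℕ} (P : Pol d m n) : ℕ := (ratMatrix P).rank

/-- Offset of the `b`-th diagonal block when block `j` has size `sz j`. -/
def off (sz : ℕ → ℕ) (b : ℕ) : ℕ := ∑ j ∈ Finset.range b, sz j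

/-- The `p × q` matrix given as a direct sum of `N` diagonal blocks, where block `b`
has size `ρ b × γ b` and entries `ent b`, blocks being laid out along the diagonal
in order (block `b` occupies rows `[off ρ b, off ρ b + ρ b)` and columns
`[off γ b, off γ b + γ b)`); all other entries are zero. -/
noncomputable def dsum (N : ℕ) (ρ γ : ℕ → ℕ) (ent : ℕ → ℕ → ℕ → ℂ) (p q : ℕ) :
    Matrix (Fin p) (Fin q) ℂ := fun x y =>
  ∑ b ∈ Finset.range N,
    if off ρ b ≤ (x:ℕ) ∧ (x:ℕ) < off ρ b + ρ b ∧ off γ b ≤ (y:ℕ) ∧ (y:ℕ) < off γ b + γ b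
    then ent b ((x:ℕ) - off ρ b) ((y:ℕ) - off γ b) else 0

/-- Sizes of the four sections of blocks: `c₁` blocks of size `v₁`, then `c₂` of size
`v₂`, then `c₃` of size `v₃`, then the rest of size `v₄`. -/
def secSize (c₁ c₂ c₃ : ℕ) (v₁ v₂ v₃ v₄ : ℕ) (i : ℕ) : ℕ :=
  if i < c₁ then v₁ else if i < c₁ + c₂ then v₂ else if i < c₁ + c₂ + c₃ then v₃ else v₄

/-- The `p × q` pencil which is the direct sum of `c₁` copies of `L_{e₁}`, `c₂` copies
of `L_{e₂}`, `c₃` copies of `L_{f₁}ᵀ` and `c₄` copies of `L_{f₂}ᵀ`.  Here `L_k` is the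
`k × (k+1)` pencil `λ G_k + F_k` with `G_k` having ones in entries `(i,i)` and `F_k`
having ones in entries `(i,i+1)`. -/
noncomputable def genPencil (c₁ c₂ c₃ c₄ e₁ e₂ f₁ f₂ p q : ℕ) : Pencil p q :=
  (dsum (c₁+c₂+c₃+c₄) (secSize c₁ c₂ c₃ e₁ e₂ (f₁+1) (f₂+1))
     (secSize c₁ c₂ c₃ (e₁+1) (e₂+1) f₁ f₂)
     (fun _ i j => if i = j then 1 else 0) p q,
   dsum (c₁+c₂+c₃+c₄) (secSize c₁ c₂ c₃ e₁ e₂ (f₁+1) (f₂+1))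
     (secSize c₁ c₂ c₃ (e₁+1) (e₂+1) f₁ f₂)
     (fun b i j => if b < c₁ + c₂ then (if j = i+1 then 1 else 0)
       else (if i = j+1 then 1 else 0)) p q)

/-- The generic pencil `G_a` of Theorem 3.2 (viewed at grade `d`):  the direct sum of
`s` copies of `L_{α+d}`, `n−r−s` copies of `L_{α+d−1}`, `t` copies of `L_{β+1}ᵀ` and
`m−r−t` copies of `L_βᵀ`, where `α = ⌊a/(n−r)⌋`, `s = a mod (n−r)`,
`β = ⌊(rd−a)/(m−r)⌋`, `t = (rd−a) mod (m−r)`. -/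
noncomputable def Ga (m n d r a : ℕ) : Pencil (m + n*(d-1)) (n*d) :=
  genPencil (a % (n-r)) (n-r - a % (n-r)) ((r*d - a) % (m-r)) (m-r - (r*d - a) % (m-r))
    (a/(n-r) + d) (a/(n-r) + d - 1) ((r*d - a)/(m-r) + 1) ((r*d - a)/(m-r))
    (m + n*(d-1)) (n*d)


/-- The generic rank-`ρ` pencil of size `p × q` with parameter `b` (Theorem 3.2 of
De Terán–Dopico): direct sum of `s₁` copies of `L_{α₁+1}`, `q−ρ−s₁` copies of `L_{α₁}`,
`t₁` copies of `L_{β₁+1}ᵀ` and `p−ρ−t₁` copies of `L_{β₁}ᵀ`, where `α₁ = ⌊b/(q−ρ)⌋`,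
`s₁ = b mod (q−ρ)`, `β₁ = ⌊(ρ−b)/(p−ρ)⌋`, `t₁ = (ρ−b) mod (p−ρ)`. -/
noncomputable def Kp (p q ρ b : ℕ) : Pencil p q :=
  genPencil (b % (q-ρ)) (q-ρ - b % (q-ρ)) ((ρ-b) % (p-ρ)) (p-ρ - (ρ-b) % (p-ρ))
    (b/(q-ρ) + 1) (b/(q-ρ)) ((ρ-b)/(p-ρ) + 1) ((ρ-b)/(p-ρ)) p q

/-- The generic right-singular pencil `G_rp` (case `m < n`): direct sum of `s` copies of
`L_{α+d}` and `n−m−s` copies of `L_{α+d−1}`, with `α = ⌊md/(n−m)⌋`, `s = md mod (n−m)`. -/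
noncomputable def Grp (m n d : ℕ) : Pencil (m + n*(d-1)) (n*d) :=
  genPencil (m*d % (n-m)) (n-m - m*d % (n-m)) 0 0
    (m*d/(n-m) + d) (m*d/(n-m) + d - 1) 0 0 (m + n*(d-1)) (n*d)

/-- The generic left-singular pencil `G_ℓp` (case `m > n`): direct sum of `t` copies of
`L_{β+1}ᵀ` and `m−n−t` copies of `L_βᵀ`, with `β = ⌊nd/(m−n)⌋`, `t = nd mod (m−n)`. -/
noncomputable def Glp (m n d : ℕ) : Pencil (m + n*(d-1)) (n*d) :=
  genPencil 0 0 (n*d % (m-n)) (m-n - n*d % (m-n)) 0 0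
    (n*d/(m-n) + 1) (n*d/(m-n)) (m + n*(d-1)) (n*d)

/-- The linear map `(X, Y) ↦ (XA − AY, XB − BY)` whose range is the tangent space at
`λA+B` to the strict equivalence orbit of the pencil `λA+B`. -/
noncomputable def tangentMap {p q : ℕ} (L : Pencil p q) :
    (Matrix (Fin p) (Fin p) ℂ × Matrix (Fin q) (Fin q) ℂ) →ₗ[ℂ]
      (Matrix (Fin p) (Fin q) ℂ × Matrix (Fin p) (Fin q) ℂ) where
  toFun XY := (XY.1 * L.1 - L.1 * XY.2, XY.1 * L.2 - L.2 * XY.2)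
  map_add' X Y := by
    obtain ⟨X₁, X₂⟩ := X; obtain ⟨Y₁, Y₂⟩ := Y
    simp only [Prod.mk_add_mk, Matrix.add_mul, Matrix.mul_add, Prod.mk.injEq]
    constructor <;> abel
  map_smul' c X := by
    obtain ⟨X₁, X₂⟩ := X
    simp only [Prod.smul_mk, Matrix.smul_mul, Matrix.mul_smul, RingHom.id_apply,
      Prod.mk.injEq, smul_sub]

/-- The tangent space `T = {(XA − AY, XB − BY)}` at `λA+B` to its strict equivalence
orbit, as a subspace of the pencil space. -/
noncomputable def tangent {p q : ℕ} (L : Pencil p q) :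
    Submodule ℂ (Matrix (Fin p) (Fin q) ℂ × Matrix (Fin p) (Fin q) ℂ) :=
  LinearMap.range (tangentMap L)

/-- The first companion form `C¹_M(λ) = λ A + B` regarded as a matrix over `ℂ[λ]`. -/
noncomputable def compPoly (m n d : ℕ) (M : Pol d m n) :
    Matrix (Fin (m + n*(d-1))) (Fin (n*d)) (Polynomial ℂ) := fun i j =>
  Polynomial.C (compA m n d M i j) * Polynomial.X + Polynomial.C (compB m n d M i j)

/-- The block-diagonal matrix `diag(M(λ), I_{n(d−1)})` over `ℂ[λ]`. -/
noncomputable def polyBlock (m n d : ℕ) (M : Pol d m n) :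
    Matrix (Fin (m + n*(d-1))) (Fin (n*d)) (Polynomial ℂ) := fun i j =>
  if hi : (i : ℕ) < m then
    if hj : (j : ℕ) < n then
      ∑ k : Fin (d+1), Polynomial.C (M k ⟨i, hi⟩ ⟨j, hj⟩) * Polynomial.X ^ (k : ℕ)
    else 0
  else if (i : ℕ) - m = (j : ℕ) - n ∧ n ≤ (j : ℕ) then 1 else 0

/-- The first companion form regarded as a matrix over the field `ℂ(λ)`. -/
noncomputable def compRat (m n d : ℕ) (M : Pol d m n) :
    Matrix (Fin (m + n*(d-1))) (Fin (n*d)) (RatFunc ℂ) := fun i j =>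
  RatFunc.C (compA m n d M i j) * RatFunc.X + RatFunc.C (compB m n d M i j)


/-- Standard basis covector, zero if out of range. -/
def ev (q y : ℕ) : Fin q → ℂ := fun x => if (x:ℕ) = y then 1 else 0

lemma compA_bot (m n d : ℕ) (P : Pol d m n) (t : Fin (n*(d-1))) :
    compA m n d P (Fin.natAdd m t) = ev (n*d) (t+n) := by
  funext y
  simp only [compA, ev, Fin.val_natAdd]
  rw [dif_neg (by omega)]
  congr 1
  simp only [eq_iff_iff]
  omega

lemma compB_bot (m n d : ℕ) (P : Pol d m n) (t : Fin (n*(d-1))) :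
    compB m n d P (Fin.natAdd m t) = - ev (n*d) t := by
  funext y
  simp only [compB, ev, Fin.val_natAdd, Pi.neg_apply]
  rw [dif_neg (by omega)]
  simp only [Nat.add_sub_cancel_left]
  split_ifs <;> simp

lemma idx_lt {n d t : ℕ} (hd : 1 ≤ d) (ht : t < n*(d-1)) : t + n < n*d := by
  obtain ⟨D, rfl⟩ : ∃ D, d = D+1 := ⟨d-1, by omega⟩
  simp at ht
  rw [Nat.mul_succ]; omega

lemma exists_comp (m n d : ℕ) (hn : 0 < n) (hd : 1 ≤ d)
    (A B : Matrix (Fin (m+n*(d-1))) (Fin (n*d)) ℂ)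
    (R : Matrix (Fin (n*d)) (Fin (n*d)) ℂ) (hR : IsUnit R)
    (h : ∀ t : Fin (n*(d-1)), ∃ w, w ᵥ* A = R ⟨t+n, idx_lt hd t.2⟩ ∧
      w ᵥ* B = - R ⟨t, lt_of_le_of_lt (Nat.le_add_right _ n) (idx_lt hd t.2)⟩) :
    ∃ (P : Pol d m n) (Q : Matrix (Fin (m+n*(d-1))) (Fin (m+n*(d-1))) ℂ),
      IsUnit Q ∧ compA m n d P * R = Q * A ∧ compB m n d P * R = Q * B := by
  choose w hwA hwB using h
  have hdet : IsUnit R.det := (Matrix.isUnit_iff_isUnit_det R).1 hR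
  have hRi : R * R⁻¹ = 1 := Matrix.mul_nonsing_inv R hdet
  have hRi' : R⁻¹ * R = 1 := Matrix.nonsing_inv_mul R hdet
  have hrow : ∀ y : Fin (n*d), R y ᵥ* R⁻¹ = ev (n*d) y := by
    intro y
    have : (R * R⁻¹) y = ev (n*d) y := by
      rw [hRi]; funext z
      simp [Matrix.one_apply, ev, Fin.ext_iff, eq_comm]
    rw [← this]; rfl
  have hwA' : ∀ t, w t ᵥ* (A * R⁻¹) = ev (n*d) (t+n) := by
    intro t; rw [← Matrix.vecMul_vecMul, hwA, hrow]
  have hwB' : ∀ t, w t ᵥ* (B * R⁻¹) = - ev (n*d) t := by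
    intro t; rw [← Matrix.vecMul_vecMul, hwB, Matrix.neg_vecMul, hrow]
  set A' := A * R⁻¹ with hA'
  set B' := B * R⁻¹ with hB'
  let φ : (Fin (m+n*(d-1)) → ℂ) →ₗ[ℂ] (Fin (n*(d-1)) → ℂ) :=
    (LinearMap.funLeft ℂ ℂ (fun t : Fin (n*(d-1)) => (⟨t+n, idx_lt hd t.2⟩ : Fin (n*d)))).comp
      A'.vecMulLinear
  have hφ : ∀ x t, φ x t = (x ᵥ* A') ⟨t+n, idx_lt hd t.2⟩ := fun x t => rfl
  have hφw : ∀ t, φ (w t) = Pi.single t 1 := by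
    intro t; funext s
    rw [hφ, hwA']
    simp [ev, Pi.single_apply, Fin.ext_iff]
  have hφs : Function.Surjective φ := by
    intro z
    refine ⟨∑ t, z t • w t, ?_⟩
    simp only [map_sum, map_smul, hφw]
    funext s
    simp [Finset.sum_apply, Pi.single_apply]
  have hker : Module.finrank ℂ (LinearMap.ker φ) = m := by
    have h1 := LinearMap.finrank_range_add_finrank_ker φ
    rw [LinearMap.range_eq_top.2 hφs] at h1
    simp at h1
    omega
  let bas := Module.finBasisOfFinrankEq ℂ (LinearMap.ker φ) hker
  let u : Fin m → (Fin (m+n*(d-1)) → ℂ) := fun i => (bas i : _)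
  have hu : ∀ i, φ (u i) = 0 := fun i => (bas i).2
  have huli : LinearIndependent ℂ u :=
    bas.linearIndependent.map' (Submodule.subtype _) (Submodule.ker_subtype _)
  let Q : Matrix (Fin (m+n*(d-1))) (Fin (m+n*(d-1))) ℂ := Fin.append u w
  have hQl : ∀ i, Q (Fin.castAdd _ i) = u i := fun i => Fin.append_left u w i
  have hQr : ∀ i, Q (Fin.natAdd _ i) = w i := fun i => Fin.append_right u w i
  have hQ : IsUnit Q := by
    rw [← Matrix.linearIndependent_rows_iff_isUnit, Fintype.linearIndependent_iff]
    intro z hz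
    rw [Fin.sum_univ_add] at hz
    simp only [Matrix.row, hQl, hQr] at hz
    have h2 := congrArg φ hz
    simp only [map_add, map_sum, map_smul, hφw, hu, smul_zero, Finset.sum_const_zero, zero_add,
      map_zero] at h2
    have hb : ∀ t, z (Fin.natAdd m t) = 0 := by
      intro t
      have := congrFun h2 t
      simpa [Finset.sum_apply, Pi.single_apply] using this
    simp only [hb, zero_smul, Finset.sum_const_zero, add_zero] at hz
    have ha := Fintype.linearIndependent_iff.1 huli _ hz
    intro x
    refine Fin.addCases (fun i => ha i) (fun i => hb i) x
  let P : Pol d m n := fun k i j =>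
    if (k:ℕ) = d then (if hj : (j:ℕ) < n*d then (u i ᵥ* A') ⟨j, hj⟩ else 0)
    else (if hj : (d-1-k)*n + j < n*d then (u i ᵥ* B') ⟨(d-1-k)*n+j, hj⟩ else 0)
  have hPA : compA m n d P = Q * A' := by
    funext x
    refine Fin.addCases (fun i => ?_) (fun t => ?_) x
    · change _ = Q (Fin.castAdd _ i) ᵥ* A'
      rw [hQl]
      funext y
      by_cases hy : (y:ℕ) < n
      · simp [compA, hy, P]
      · simp only [compA, Fin.val_castAdd, i.2, dif_pos, hy, dif_neg, not_false_eq_true]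
        have hlt : (y:ℕ) - n < n*(d-1) := by
          have := y.2
          rw [Nat.mul_sub, Nat.mul_one]
          omega
        have := congrFun (hu i) ⟨y-n, hlt⟩
        rw [hφ] at this
        simp only [Pi.zero_apply] at this
        rw [← this]
        congr 1
        ext; simp; omega
    · change _ = Q (Fin.natAdd _ t) ᵥ* A'
      rw [hQr, compA_bot, hwA']
  have hPB : compB m n d P = Q * B' := by
    funext x
    refine Fin.addCases (fun i => ?_) (fun t => ?_) x
    · change _ = Q (Fin.castAdd _ i) ᵥ* B'
      rw [hQl]
      funext y
      have hyd : (y:ℕ) / n < d := Nat.div_lt_of_lt_mul y.2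
      have e0 : 0 ≤ (y:ℕ)/n := Nat.zero_le _
      have e1 : (d-1-(d-1-(y:ℕ)/n)) = y/n := by omega
      have e2 : (y:ℕ)/n*n + y%n = y := Nat.div_add_mod' _ _
      have e3 : ¬ (d - 1 - (y:ℕ)/n = d) := by omega
      simp [compB, hn, P, e1, e2, e3]
    · change _ = Q (Fin.natAdd _ t) ᵥ* B'
      rw [hQr, compB_bot, hwB']
  refine ⟨P, Q, hQ, ?_, ?_⟩
  · rw [hPA, hA', Matrix.mul_assoc, Matrix.mul_assoc, hRi', Matrix.mul_one]
  · rw [hPB, hB', Matrix.mul_assoc, Matrix.mul_assoc, hRi', Matrix.mul_one]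

/-- State of the chain construction. -/
def ChSt {V : Type} [AddCommGroup V] [Module ℂ V] (d : ℕ) (Lk : V → V → Prop) (M : ℕ)
    (W : Submodule ℂ V) : Prop :=
  ∃ (N c : ℕ) (C : ℕ → ℕ → V) (O : ℕ → V), c < d ∧ N*d + c = M ∧
    (∀ j < N, ∀ k, k+1 < d → Lk (C j k) (C j (k+1))) ∧
    (∀ k, k+1 < d → Lk (O k) (O (k+1))) ∧ (∀ k < d, O k ∈ W) ∧
    ∀ S : Submodule ℂ V, (∀ j < N, ∀ k < d, C j k ∈ S) → (∀ k < d, d - c ≤ k → O k ∈ S) → W ≤ S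

lemma chSt_init {V : Type} [AddCommGroup V] [Module ℂ V] (d : ℕ) (hd : 1 ≤ d) (Lk : V → V → Prop)
    (T : ℕ) (s : ℕ → V) (W : Submodule ℂ V) (h00 : Lk 0 0) (h0 : Lk 0 (s 0))
    (hs : ∀ i, Lk (s i) (s (i+1))) (hW : W = Submodule.span ℂ {v | ∃ i < T, v = s i})
    (hs0 : ∀ i, T ≤ i → s i = 0) :
    ChSt d Lk T W := by
  have hmem : ∀ i, s i ∈ W := by
    intro i
    by_cases hi : i < T
    · rw [hW]; exact Submodule.subset_span ⟨i, hi, rfl⟩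
    · rw [hs0 i (by omega)]; exact zero_mem _
  have hc : T % d < d := Nat.mod_lt _ hd
  refine ⟨T / d, T % d, fun j k => s (T % d + j*d + k),
    fun k => if k < d - T % d then 0 else s (k - (d - T % d)), hc, Nat.div_add_mod' _ _, ?_, ?_, ?_, ?_⟩
  · intro j _ k _; exact hs _
  · intro k hk
    dsimp only
    by_cases h1 : k + 1 < d - T % d
    · rw [if_pos (by omega), if_pos h1]; exact h00
    · by_cases h2 : k < d - T % d
      · rw [if_pos h2, if_neg h1, show k + 1 - (d - T % d) = 0 by omega]; exact h0
      · rw [if_neg h2, if_neg h1, show k + 1 - (d - T % d) = k - (d - T % d) + 1 by omega]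
        exact hs _
  · intro k _
    dsimp only
    split_ifs
    · exact zero_mem _
    · exact hmem _
  · intro S h1 h2
    dsimp only at h1 h2
    rw [hW, Submodule.span_le]
    rintro _ ⟨i, hi, rfl⟩
    by_cases hic : i < T % d
    · have := h2 (i + (d - T % d)) (by omega) (by omega)
      rw [if_neg (by omega)] at this
      simpa using this
    · have e1 := Nat.div_add_mod' (i - T % d) d
      have e2 := Nat.div_add_mod' T d
      have e3 : (i - T % d) % d < d := Nat.mod_lt _ hd
      have e4 : (i - T % d) / d < T / d := by
        apply Nat.div_lt_of_lt_mul
        rw [mul_comm]; omega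
      have := h1 _ e4 _ e3
      rw [add_assoc, e1] at this
      rwa [show T % d + (i - T % d) = i by omega] at this

lemma chSt_step {V : Type} [AddCommGroup V] [Module ℂ V] (d : ℕ) (hd : 1 ≤ d) (Lk : V → V → Prop)
    (hadd : ∀ x y x' y', Lk x y → Lk x' y' → Lk (x+x') (y+y'))
    (M : ℕ) (W : Submodule ℂ V) (hSt : ChSt d Lk M W) (l : ℕ) (hl : d ≤ l) (u : ℕ → V)
    (hu : ∀ i, i + 1 < l → Lk (u i) (u (i+1))) :
    ChSt d Lk (M + l) (W ⊔ Submodule.span ℂ {v | ∃ i < l, v = u i}) := by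
  obtain ⟨N, c, C, O, hc, hM, hC, hO, hOW, hS⟩ := hSt
  set l' := l - (d - c) with hl'
  have e2 := Nat.div_add_mod' l' d
  have hc' : l' % d < d := Nat.mod_lt _ hd
  have hq0 : 0 ≤ l' / d := Nat.zero_le _
  have hm : ∀ i < l, u i ∈ Submodule.span ℂ {v | ∃ i < l, v = u i} := fun i hi =>
    Submodule.subset_span ⟨i, hi, rfl⟩
  refine ⟨N + 1 + l' / d, l' % d, fun j k => if j < N then C j k else if j = N then O k + u k else
    u (d - c + (j - (N+1)) * d + k), fun k => u (l - d + k), hc', ?_, ?_, ?_, ?_, ?_⟩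
  · rw [add_mul, add_mul]; omega
  · intro j hj k hk
    dsimp only
    by_cases h1 : j < N
    · rw [if_pos h1, if_pos h1]; exact hC j h1 k hk
    · by_cases h2 : j = N
      · rw [if_neg h1, if_neg h1, if_pos h2, if_pos h2]
        exact hadd _ _ _ _ (hO k hk) (hu k (by omega))
      · rw [if_neg h1, if_neg h1, if_neg h2, if_neg h2]
        apply hu
        have : (j - (N+1) + 1) * d ≤ l' / d * d := Nat.mul_le_mul_right _ (by omega)
        rw [add_mul] at this
        omega
  · intro k hk
    exact hu _ (by omega)
  · intro k hk
    exact Submodule.mem_sup_right (hm _ (by omega))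
  · intro S h1 h2
    dsimp only at h1 h2
    have k1 : ∀ j < N, ∀ k < d, C j k ∈ S := by
      intro j hj k hk
      have := h1 j (by omega) k hk
      rwa [if_pos hj] at this
    have k2 : ∀ k < d, O k + u k ∈ S := by
      intro k hk
      have := h1 N (by omega) k hk
      rwa [if_neg (by omega), if_pos rfl] at this
    have k3 : ∀ i < l, d - c ≤ i → u i ∈ S := by
      intro i hi hic
      by_cases hx : i - (d - c) < l' / d * d
      · have e1 := Nat.div_add_mod' (i - (d - c)) d
        have e3 : (i - (d-c)) % d < d := Nat.mod_lt _ hd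
        have e5 : 0 ≤ (i - (d-c)) / d := Nat.zero_le _
        have e4 : (i - (d-c)) / d < l' / d := by
          apply Nat.div_lt_of_lt_mul
          rw [mul_comm]; omega
        have := h1 (N + 1 + (i - (d-c)) / d) (by omega) _ e3
        rw [if_neg (by omega), if_neg (by omega), Nat.add_sub_cancel_left, add_assoc, e1] at this
        rwa [show d - c + (i - (d - c)) = i by omega] at this
      · have := h2 (i - (l - d)) (by omega) (by omega)
        rwa [show l - d + (i - (l-d)) = i by omega] at this
    have k4 : W ≤ S := by
      apply hS S k1
      intro k hk hkc
      have := S.sub_mem (k2 k hk) (k3 k (by omega) hkc)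
      simpa using this
    refine sup_le k4 ?_
    rw [Submodule.span_le]
    rintro _ ⟨i, hi, rfl⟩
    by_cases hx : d - c ≤ i
    · exact k3 i hi hx
    · have := S.sub_mem (k2 i (by omega)) (k4 (hOW i (by omega)))
      simpa using this

lemma off_succ (γ : ℕ → ℕ) (b : ℕ) : off γ (b+1) = off γ b + γ b := by
  simp [off, Finset.sum_range_succ]

lemma off_mono (γ : ℕ → ℕ) {b c : ℕ} (h : b ≤ c) : off γ b ≤ off γ c := by
  induction h with
  | refl => exact le_rfl
  | step _ ih => rw [off_succ]; omega

lemma off_find (γ : ℕ → ℕ) (N y : ℕ) (h : y < off γ N) :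
    ∃ b i, b < N ∧ i < γ b ∧ y = off γ b + i := by
  induction N with
  | zero => simp [off] at h
  | succ N ih =>
    by_cases hy : y < off γ N
    · obtain ⟨b, i, h1, h2, h3⟩ := ih hy
      exact ⟨b, i, by omega, h2, h3⟩
    · rw [off_succ] at h
      exact ⟨N, y - off γ N, by omega, by omega, by omega⟩

lemma off_uniq (γ : ℕ → ℕ) {b c i j : ℕ} (hi : i < γ b) (hj : j < γ c)
    (h : off γ b + i = off γ c + j) : b = c := by
  rcases lt_trichotomy b c with h1 | h1 | h1
  · have := off_mono γ (show b + 1 ≤ c from h1)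
    rw [off_succ] at this; omega
  · exact h1
  · have := off_mono γ (show c + 1 ≤ b from h1)
    rw [off_succ] at this; omega

lemma block_sum {M : Type} [AddCommMonoid M] (γ : ℕ → ℕ) (N b i : ℕ) (hb : b < N) (hi : i < γ b)
    (g : ℕ → M) :
    ∑ c ∈ Finset.range N, (if off γ c ≤ off γ b + i ∧ off γ b + i < off γ c + γ c then g c else 0)
      = g b := by
  rw [Finset.sum_eq_single b]
  · rw [if_pos]; omega
  · intro c _ hcb
    rw [if_neg]
    rintro ⟨h1, h2⟩
    exact hcb (off_uniq γ (b := c) (c := b) (i := off γ b + i - off γ c) (j := i)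
      (by omega) hi (by omega))
  · intro h; exact absurd (Finset.mem_range.2 hb) h

lemma dsum_row (N : ℕ) (ρ γ : ℕ → ℕ) (ent : ℕ → ℕ → ℕ → ℂ) (p q b i : ℕ) (hb : b < N)
    (hi : i < ρ b) (x : Fin p) (hx : (x:ℕ) = off ρ b + i) (y : Fin q) :
    dsum N ρ γ ent p q x y =
      if off γ b ≤ (y:ℕ) ∧ (y:ℕ) < off γ b + γ b then ent b i (y - off γ b) else 0 := by
  unfold dsum
  rw [hx]
  have := block_sum ρ N b i hb hi (fun c => if off γ c ≤ (y:ℕ) ∧ (y:ℕ) < off γ c + γ c then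
    ent c (off ρ b + i - off ρ c) (y - off γ c) else 0)
  rw [Nat.add_sub_cancel_left] at this
  rw [← this]
  apply Finset.sum_congr rfl
  intro c _
  split_ifs <;> first | rfl | omega

/-- A pencil that is a direct sum of `h` right singular blocks followed by left singular blocks. -/
structure KB (p q N h : ℕ) (ρ γ : ℕ → ℕ) (A B : Matrix (Fin p) (Fin q) ℂ) : Prop where
  hN : h ≤ N
  hp : off ρ N = p
  hq : off γ N = q
  hL : ∀ b < h, γ b = ρ b + 1
  hLT : ∀ b, h ≤ b → b < N → ρ b = γ b + 1
  hA : ∀ b < N, ∀ i < ρ b, ∀ x : Fin p, (x:ℕ) = off ρ b + i →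
    A x = if i < γ b then ev q (off γ b + i) else 0
  hB : ∀ b < N, ∀ i < ρ b, ∀ x : Fin p, (x:ℕ) = off ρ b + i →
    B x = if b < h then ev q (off γ b + i + 1) else if i = 0 then 0 else ev q (off γ b + i - 1)

lemma off_secSize (c₁ c₂ c₃ c₄ v₁ v₂ v₃ v₄ : ℕ) :
    off (secSize c₁ c₂ c₃ v₁ v₂ v₃ v₄) (c₁+c₂+c₃+c₄) = c₁*v₁+c₂*v₂+c₃*v₃+c₄*v₄ := by
  unfold off
  rw [Finset.sum_range_add, Finset.sum_range_add, Finset.sum_range_add]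
  congr 1
  · congr 1
    · congr 1
      · rw [Finset.sum_congr rfl (g := fun _ => v₁)]
        · simp
        · intro i hi; have := Finset.mem_range.1 hi; simp [secSize, this]
      · rw [Finset.sum_congr rfl (g := fun _ => v₂)]
        · simp
        · intro i hi; have := Finset.mem_range.1 hi; simp [secSize, this]
    · rw [Finset.sum_congr rfl (g := fun _ => v₃)]
      · simp
      · intro i hi; have := Finset.mem_range.1 hi
        unfold secSize
        rw [if_neg (by omega), if_neg (by omega), if_pos (by omega)]
  · rw [Finset.sum_congr rfl (g := fun _ => v₄)]
    · simp
    · intro i hi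
      unfold secSize
      rw [if_neg (by omega), if_neg (by omega), if_neg (by omega)]

lemma genPencil_KB (c₁ c₂ c₃ c₄ e₁ e₂ f₁ f₂ p q : ℕ)
    (hp : c₁*e₁+c₂*e₂+c₃*(f₁+1)+c₄*(f₂+1) = p)
    (hq : c₁*(e₁+1)+c₂*(e₂+1)+c₃*f₁+c₄*f₂ = q) :
    KB p q (c₁+c₂+c₃+c₄) (c₁+c₂) (secSize c₁ c₂ c₃ e₁ e₂ (f₁+1) (f₂+1))
     (secSize c₁ c₂ c₃ (e₁+1) (e₂+1) f₁ f₂) (genPencil c₁ c₂ c₃ c₄ e₁ e₂ f₁ f₂ p q).1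
     (genPencil c₁ c₂ c₃ c₄ e₁ e₂ f₁ f₂ p q).2 := by
  have hL : ∀ b < c₁+c₂, secSize c₁ c₂ c₃ (e₁+1) (e₂+1) f₁ f₂ b
      = secSize c₁ c₂ c₃ e₁ e₂ (f₁+1) (f₂+1) b + 1 := by
    intro b hb
    unfold secSize
    split_ifs <;> rfl
  have hLT : ∀ b, c₁+c₂ ≤ b → secSize c₁ c₂ c₃ e₁ e₂ (f₁+1) (f₂+1) b
      = secSize c₁ c₂ c₃ (e₁+1) (e₂+1) f₁ f₂ b + 1 := by
    intro b hb
    unfold secSize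
    split_ifs <;> first | rfl | omega
  refine ⟨by omega, ?_, ?_, hL, fun b h _ => hLT b h, ?_, ?_⟩
  · rw [off_secSize, hp]
  · rw [off_secSize, hq]
  · intro b hb i hi x hx
    funext y
    simp only [genPencil]
    rw [dsum_row _ _ _ _ _ _ b i hb hi x hx y]
    by_cases h : i < secSize c₁ c₂ c₃ (e₁+1) (e₂+1) f₁ f₂ b
    · rw [if_pos h]
      unfold ev
      split_ifs <;> first | rfl | omega
    · rw [if_neg h]
      simp only [Pi.zero_apply]
      split_ifs <;> first | rfl | omega
  · intro b hb i hi x hx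
    funext y
    simp only [genPencil]
    rw [dsum_row _ _ _ _ _ _ b i hb hi x hx y]
    by_cases h : b < c₁ + c₂
    · rw [if_pos h, if_pos h]
      have := hL b h
      unfold ev
      split_ifs <;> first | rfl | omega
    · rw [if_neg h, if_neg h]
      have := hLT b (by omega)
      by_cases h0 : i = 0
      · rw [if_pos h0]
        simp only [Pi.zero_apply]
        split_ifs <;> first | rfl | omega
      · rw [if_neg h0]
        unfold ev
        split_ifs <;> first | rfl | omega

lemma Ga_KB (m n d r a : ℕ) (hd : 1 ≤ d) (hrm : r < m) (hrn : r < n) (ha : a ≤ r*d) :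
    ∃ N ρ γ, KB (m+n*(d-1)) (n*d) N (n-r) ρ γ (Ga m n d r a).1 (Ga m n d r a).2 ∧
      ∀ b < n-r, d ≤ γ b := by
  have h1 : a % (n-r) < n-r := Nat.mod_lt _ (by omega)
  have h2 : (r*d-a) % (m-r) < m-r := Nat.mod_lt _ (by omega)
  have h3 := Nat.div_add_mod' a (n-r)
  have h4 := Nat.div_add_mod' (r*d-a) (m-r)
  have key := genPencil_KB (a % (n-r)) (n-r - a % (n-r)) ((r*d - a) % (m-r))
    (m-r - (r*d - a) % (m-r))
    (a/(n-r) + d) (a/(n-r) + d - 1) ((r*d - a)/(m-r) + 1) ((r*d - a)/(m-r))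
    (m + n*(d-1)) (n*d)
  generalize hα : a/(n-r) = α at *
  generalize hs : a%(n-r) = s at *
  generalize hβ : (r*d-a)/(m-r) = β at *
  generalize ht : (r*d-a)%(m-r) = t at *
  have e5 : s + (n-r-s) = n-r := by omega
  obtain ⟨D, rfl⟩ : ∃ D, d = D+1 := ⟨d-1, by omega⟩
  obtain ⟨s', hs'⟩ : ∃ s', n - r = s + s' := ⟨n-r-s, by omega⟩
  obtain ⟨t', ht'⟩ : ∃ t', m - r = t + t' := ⟨m-r-t, by omega⟩
  have hn : n = r + (s+s') := by omega
  have hm : m = r + (t+t') := by omega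
  obtain ⟨z, hz⟩ : ∃ z, r*(D+1) = a + z := ⟨r*(D+1)-a, by omega⟩
  have h4' : β*(t+t') + t = z := by rw [← ht']; omega
  have h3' : α*(s+s') + s = a := by rw [← hs']; omega
  have k1 : n - r - s = s' := by omega
  have k2 : m - r - t = t' := by omega
  have k3 : α + (D+1) - 1 = α + D := by omega
  rw [k1, k2, k3, Nat.add_sub_cancel] at key
  specialize key (by subst hn; subst hm; zify at *; linear_combination h3' + h4' - hz)
    (by subst hn; zify at *; linear_combination h3' + h4' - hz)
  refine ⟨s+s'+t+t', secSize s s' t (α + (D + 1)) (α + D) (β + 1 + 1) (β + 1),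
    secSize s s' t (α + (D + 1) + 1) (α + D + 1) (β + 1) β, ?_, ?_⟩
  · unfold Ga
    rw [hα, hs, hβ, ht, k1, k2, k3, hs']
    exact key
  · intro b hb
    unfold secSize
    split_ifs <;> omega

/-- `x` and `y` are the two coefficients of a combination of the rows of the pencil. -/
def Lk {p q : ℕ} (A B : Matrix (Fin p) (Fin q) ℂ) (x y : Fin q → ℂ) : Prop :=
  ∃ w : Fin p → ℂ, w ᵥ* A = x ∧ w ᵥ* B = y

lemma Lk_add {p q : ℕ} (A B : Matrix (Fin p) (Fin q) ℂ) (x y x' y' : Fin q → ℂ)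
    (h : Lk A B x y) (h' : Lk A B x' y') : Lk A B (x+x') (y+y') := by
  obtain ⟨w, h1, h2⟩ := h
  obtain ⟨w', h1', h2'⟩ := h'
  exact ⟨w + w', by rw [Matrix.add_vecMul, h1, h1'], by rw [Matrix.add_vecMul, h2, h2']⟩

lemma Lk_smul {p q : ℕ} (A B : Matrix (Fin p) (Fin q) ℂ) (c : ℂ) (x y : Fin q → ℂ)
    (h : Lk A B x y) : Lk A B (c • x) (c • y) := by
  obtain ⟨w, h1, h2⟩ := h
  exact ⟨c • w, by rw [Matrix.smul_vecMul, h1], by rw [Matrix.smul_vecMul, h2]⟩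

lemma Lk_row {p q : ℕ} (A B : Matrix (Fin p) (Fin q) ℂ) (x : Fin p) : Lk A B (A x) (B x) :=
  ⟨Pi.single x 1, by rw [Matrix.single_one_vecMul]; rfl, by rw [Matrix.single_one_vecMul]; rfl⟩

lemma KB.row {p q N h : ℕ} {ρ γ : ℕ → ℕ} {A B : Matrix (Fin p) (Fin q) ℂ}
    (K : KB p q N h ρ γ A B) (b i : ℕ) (hb : b < N) (hi : i < ρ b) :
    ∃ x : Fin p, (x:ℕ) = off ρ b + i := by
  have := off_mono ρ (show b + 1 ≤ N from hb)
  rw [off_succ, K.hp] at this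
  exact ⟨⟨off ρ b + i, by omega⟩, rfl⟩

lemma KB.link {p q N h : ℕ} {ρ γ : ℕ → ℕ} {A B : Matrix (Fin p) (Fin q) ℂ}
    (K : KB p q N h ρ γ A B) (b i : ℕ) (hb : b < N) (hi : i < ρ b) :
    Lk A B (if i < γ b then ev q (off γ b + i) else 0)
      (if b < h then ev q (off γ b + i + 1) else if i = 0 then 0 else ev q (off γ b + i - 1)) := by
  obtain ⟨x, hx⟩ := K.row b i hb hi
  rw [← K.hA b hb i hi x hx, ← K.hB b hb i hi x hx]
  exact Lk_row A B x

lemma KB.find {p q N h : ℕ} {ρ γ : ℕ → ℕ} {A B : Matrix (Fin p) (Fin q) ℂ}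
    (K : KB p q N h ρ γ A B) (y : ℕ) (h1 : off γ h ≤ y) (h2 : y < q) :
    ∃ b i, h ≤ b ∧ b < N ∧ i < γ b ∧ y = off γ b + i := by
  rw [← K.hq] at h2
  obtain ⟨b, i, h3, h4, h5⟩ := off_find γ N y h2
  refine ⟨b, i, ?_, h3, h4, h5⟩
  by_contra hc
  have := off_mono γ (show b + 1 ≤ h by omega)
  rw [off_succ] at this
  omega

lemma KB.linkT {p q N h : ℕ} {ρ γ : ℕ → ℕ} {A B : Matrix (Fin p) (Fin q) ℂ}
    (K : KB p q N h ρ γ A B) (y : ℕ) (h1 : off γ h ≤ y) (h2 : y + 1 < q) :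
    Lk A B (ev q (y+1)) (ev q y) := by
  obtain ⟨b, i, hb, hbN, hi, hy⟩ := K.find y h1 (by omega)
  have hr := K.hLT b hb hbN
  have k1 := K.link b (i+1) hbN (by omega)
  rw [if_neg (show ¬ b < h by omega), if_neg (show ¬ i+1=0 by omega),
    show off γ b + (i+1) - 1 = y by omega, show off γ b + (i+1) = y+1 by omega] at k1
  by_cases hc : i + 1 < γ b
  · rwa [if_pos hc] at k1
  · rw [if_neg hc] at k1
    obtain ⟨b2, i2, hb2, hbN2, hi2, hy2⟩ := K.find (y+1) (by omega) h2
    have hlt : b < b2 := by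
      by_contra hcon
      have := off_mono γ (show b2 + 1 ≤ b + 1 by omega)
      rw [off_succ, off_succ] at this
      omega
    have := off_mono γ (show b + 1 ≤ b2 by omega)
    rw [off_succ] at this
    have hi0 : i2 = 0 := by omega
    have hr2 := K.hLT b2 hb2 hbN2
    have k2 := K.link b2 i2 hbN2 (by omega)
    rw [if_pos hi2, if_neg (show ¬ b2 < h by omega), if_pos hi0, ← hy2] at k2
    simpa using Lk_add _ _ _ _ _ _ k1 k2

lemma KB.linkT_first {p q N h : ℕ} {ρ γ : ℕ → ℕ} {A B : Matrix (Fin p) (Fin q) ℂ}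
    (K : KB p q N h ρ γ A B) (h2 : off γ h < q) :
    Lk A B (ev q (off γ h)) 0 := by
  obtain ⟨b, i, hb, hbN, hi, hy⟩ := K.find _ le_rfl h2
  have := off_mono γ hb
  have hi0 : i = 0 := by omega
  have hr := K.hLT b hb hbN
  have k2 := K.link b i hbN (by omega)
  rwa [if_pos hi, if_neg (show ¬ b < h by omega), if_pos hi0, ← hy] at k2

lemma KB.linkT_last {p q N h : ℕ} {ρ γ : ℕ → ℕ} {A B : Matrix (Fin p) (Fin q) ℂ}
    (K : KB p q N h ρ γ A B) (h2 : off γ h < q) :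
    Lk A B 0 (ev q (q-1)) := by
  obtain ⟨b, i, hb, hbN, hi, hy⟩ := K.find (q-1) (by omega) (by omega)
  have hr := K.hLT b hb hbN
  have := off_mono γ (show b + 1 ≤ N by omega)
  rw [off_succ, K.hq] at this
  have k1 := K.link b (i+1) hbN (by omega)
  rwa [if_neg (show ¬ b < h by omega), if_neg (show ¬ i+1=0 by omega),
    show off γ b + (i+1) - 1 = q-1 by omega, if_neg (by omega)] at k1

lemma KB.chains {p q N h : ℕ} {ρ γ : ℕ → ℕ} {A B : Matrix (Fin p) (Fin q) ℂ}
    (K : KB p q N h ρ γ A B) (d : ℕ) (hd : 1 ≤ d) (hγ : ∀ b < h, d ≤ γ b) :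
    ChSt d (Lk A B) q ⊤ := by
  have hoff : off γ h ≤ q := by rw [← K.hq]; exact off_mono γ K.hN
  have h00 : Lk A B 0 0 := ⟨0, by simp, by simp⟩
  have main : ∀ b ≤ h, ∃ W, ChSt d (Lk A B) (q - off γ h + off γ b) W ∧
      (∀ y, y < q → off γ h ≤ y → ev q y ∈ W) ∧ (∀ y < off γ b, ev q y ∈ W) := by
    intro b
    induction b with
    | zero =>
      intro _
      refine ⟨_, chSt_init d hd (Lk A B) (q - off γ h)
        (fun i => if i < q - off γ h then ev q (q-1-i) else 0) _ h00 ?_ ?_ rfl ?_, ?_, ?_⟩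
      · skip
        split_ifs with h1
        · exact K.linkT_last (by omega)
        · exact h00
      · intro i
        by_cases h1 : i + 1 < q - off γ h
        · rw [if_pos (by omega), if_pos h1]
          have := K.linkT (q-1-(i+1)) (by omega) (by omega)
          rwa [show q-1-(i+1)+1 = q-1-i by omega] at this
        · rw [if_neg h1]
          by_cases h2 : i < q - off γ h
          · rw [if_pos h2, show q-1-i = off γ h by omega]
            exact K.linkT_first (by omega)
          · rw [if_neg h2]; exact h00
      · intro i hi
        exact if_neg (by omega)
      · intro y hy hy2
        refine Submodule.subset_span ⟨q-1-y, by omega, ?_⟩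
        rw [if_pos (by omega), show q-1-(q-1-y) = y by omega]
      · intro y hy
        simp [off] at hy
    | succ b ih =>
      intro hb
      obtain ⟨W, hW, h1, h2⟩ := ih (by omega)
      have hst := chSt_step d hd (Lk A B) (Lk_add A B) _ W hW (γ b) (hγ b (by omega))
        (fun i => ev q (off γ b + i)) (by
          intro i hi
          have hr := K.hL b (by omega)
          have := K.link b i (by have := K.hN; omega) (by omega)
          rwa [if_pos (by omega), if_pos (by omega)] at this)
      rw [add_assoc, ← off_succ] at hst
      refine ⟨_, hst, fun y hy hy2 => Submodule.mem_sup_left (h1 y hy hy2), ?_⟩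
      intro y hy
      by_cases hyb : y < off γ b
      · exact Submodule.mem_sup_left (h2 y hyb)
      · rw [off_succ] at hy
        refine Submodule.mem_sup_right (Submodule.subset_span ⟨y - off γ b, by omega, ?_⟩)
        rw [show off γ b + (y - off γ b) = y by omega]
  obtain ⟨W, hW, h1, h2⟩ := main h le_rfl
  have hWtop : W = ⊤ := by
    rw [eq_top_iff, ← (Pi.basisFun ℂ (Fin q)).span_eq, Submodule.span_le]
    rintro _ ⟨y, rfl⟩
    have : (Pi.basisFun ℂ (Fin q)) y = ev q y := by
      funext z
      simp [ev, Pi.single_apply, Fin.ext_iff]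
    rw [this]
    by_cases hy : (y:ℕ) < off γ h
    · exact h2 y hy
    · exact h1 y y.2 (by omega)
  rwa [hWtop, Nat.sub_add_cancel hoff] at hW

lemma exists_R (n d p : ℕ) (hn : 0 < n) (hd : 1 ≤ d) (A B : Matrix (Fin p) (Fin (n*d)) ℂ)
    (h : ChSt d (Lk A B) (n*d) ⊤) :
    ∃ R : Matrix (Fin (n*d)) (Fin (n*d)) ℂ, IsUnit R ∧
    ∀ t : Fin (n*(d-1)), ∃ w, w ᵥ* A = R ⟨t+n, idx_lt hd t.2⟩ ∧
      w ᵥ* B = - R ⟨t, lt_of_le_of_lt (Nat.le_add_right _ n) (idx_lt hd t.2)⟩ := by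
  obtain ⟨N, c, C, O, hc, hM, hC, -, -, hS⟩ := h
  have hc0 : c = 0 := by
    have := congrArg (· % d) hM
    simpa [Nat.mod_eq_of_lt hc] using this
  have hNn : N = n := by
    subst hc0
    exact Nat.eq_of_mul_eq_mul_right (by omega) hM
  subst hNn
  subst hc0
  let R : Matrix (Fin (N*d)) (Fin (N*d)) ℂ := fun y => (-1:ℂ)^((y:ℕ)/N) • C (y%N) (d-1-y/N)
  refine ⟨R, ?_, ?_⟩
  · rw [← Matrix.linearIndependent_rows_iff_isUnit]
    apply linearIndependent_of_top_le_span_of_card_eq_finrank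
    · apply hS
      · intro j hj k hk
        have hlt : (d-1-k)*N + j < N*d := by
          have : (d-1-k+1)*N ≤ d*N := Nat.mul_le_mul_right _ (by omega)
          rw [add_mul] at this
          rw [mul_comm N d]; omega
        have hmem : R.row ⟨_, hlt⟩ ∈ Submodule.span ℂ (Set.range R.row) :=
          Submodule.subset_span ⟨_, rfl⟩
        have e1 : ((d-1-k)*N + j) / N = d-1-k := by
          rw [mul_comm, Nat.mul_add_div hn, Nat.div_eq_of_lt hj, add_zero]
        have e2 : ((d-1-k)*N + j) % N = j := by
          rw [mul_comm, Nat.mul_add_mod, Nat.mod_eq_of_lt hj]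
        simp only [Matrix.row, R, e1, e2] at hmem
        rw [show d-1-(d-1-k) = k by omega] at hmem
        rwa [Submodule.smul_mem_iff _ (pow_ne_zero _ (by norm_num))] at hmem
      · intro k hk hk2; omega
    · simp
  · intro t
    have h1 : ((t:ℕ)+N)/N = t/N+1 := Nat.add_div_right _ hn
    have h2 : ((t:ℕ)+N)%N = t%N := Nat.add_mod_right _ _
    have h3 : (t:ℕ)/N < d-1 := Nat.div_lt_of_lt_mul t.2
    have h0 : 0 ≤ (t:ℕ)/N := Nat.zero_le _
    have := Lk_smul A B ((-1)^((t:ℕ)/N+1)) _ _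
      (hC (t%N) (Nat.mod_lt _ hn) (d-1-(t/N+1)) (by omega))
    rw [show d-1-((t:ℕ)/N+1)+1 = d-1-t/N by omega] at this
    obtain ⟨w, hw1, hw2⟩ := this
    refine ⟨w, ?_, ?_⟩
    · rw [hw1]; simp only [R, h1, h2]
    · rw [hw2]; simp only [R, pow_succ, mul_neg_one, neg_smul]

/-- Extension by zero. -/
noncomputable def ex {F : Type} [Field F] {q : ℕ} (v : Fin q → F) (y : ℕ) : F :=
  if h : y < q then v ⟨y, h⟩ else 0

lemma ev_dot {F : Type} [Field F] (f : ℂ →+* F) {q : ℕ} (y : ℕ) (v : Fin q → F) :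
    (fun x => f (ev q y x)) ⬝ᵥ v = ex v y := by
  unfold ex dotProduct ev
  split_ifs with h
  · rw [Finset.sum_eq_single ⟨y, h⟩]
    · simp
    · intro b _ hb
      have : ¬ ((b:ℕ) = y) := fun hc => hb (Fin.ext hc)
      simp [this]
    · simp
  · apply Finset.sum_eq_zero
    intro x _
    have : ¬ ((x:ℕ) = y) := by have := x.2; omega
    simp [this]

/-- The pencil as a matrix over the field of rational functions. -/
noncomputable def pm {p q : ℕ} (A B : Matrix (Fin p) (Fin q) ℂ) :
    Matrix (Fin p) (Fin q) (RatFunc ℂ) :=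
  (RatFunc.X : RatFunc ℂ) • A.map (fun z => (RatFunc.C z : RatFunc ℂ)) +
    B.map (fun z => (RatFunc.C z : RatFunc ℂ))

lemma pm_mulVec {p q : ℕ} (A B : Matrix (Fin p) (Fin q) ℂ) (v : Fin q → RatFunc ℂ) (x : Fin p) :
    (pm A B *ᵥ v) x = RatFunc.X * ((fun y => RatFunc.C (A x y)) ⬝ᵥ v) +
      (fun y => RatFunc.C (B x y)) ⬝ᵥ v := by
  unfold pm
  rw [Matrix.add_mulVec, Matrix.smul_mulVec]
  rfl

lemma KB.pm_row {p q N h : ℕ} {ρ γ : ℕ → ℕ} {A B : Matrix (Fin p) (Fin q) ℂ}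
    (K : KB p q N h ρ γ A B) (v : Fin q → RatFunc ℂ) (b i : ℕ) (hb : b < N) (hi : i < ρ b)
    (x : Fin p) (hx : (x:ℕ) = off ρ b + i) :
    (pm A B *ᵥ v) x = RatFunc.X * (if i < γ b then ex v (off γ b + i) else 0) +
      (if b < h then ex v (off γ b + i + 1) else if i = 0 then 0 else ex v (off γ b + i - 1)) := by
  rw [pm_mulVec, K.hA b hb i hi x hx, K.hB b hb i hi x hx]
  congr 1
  · congr 1
    split_ifs
    · exact ev_dot RatFunc.C _ v
    · simp [dotProduct]
  · split_ifs
    · exact ev_dot RatFunc.C _ v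
    · simp [dotProduct]
    · exact ev_dot RatFunc.C _ v

lemma KB.ker_inj {p q N h : ℕ} {ρ γ : ℕ → ℕ} {A B : Matrix (Fin p) (Fin q) ℂ}
    (K : KB p q N h ρ γ A B) (v : Fin q → RatFunc ℂ) (hv : pm A B *ᵥ v = 0)
    (h0 : ∀ b < h, ex v (off γ b) = 0) : v = 0 := by
  have key : ∀ b < N, ∀ i < γ b, ex v (off γ b + i) = 0 := by
    intro b hb i
    by_cases hbh : b < h
    · have hL := K.hL b hbh
      induction i with
      | zero => intro _; exact h0 b hbh
      | succ i ih =>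
        intro hi
        obtain ⟨x, hx⟩ := K.row b i hb (by omega)
        have := K.pm_row v b i hb (by omega) x hx
        rw [hv, if_pos (by omega), if_pos hbh, ih (by omega), add_assoc] at this
        simpa using this.symm
    · have hL := K.hLT b (by omega) hb
      induction i with
      | zero =>
        intro hi
        obtain ⟨x, hx⟩ := K.row b 0 hb (by omega)
        have := K.pm_row v b 0 hb (by omega) x hx
        rw [hv, if_pos (by omega), if_neg hbh, if_pos rfl] at this
        simpa [RatFunc.X_ne_zero] using this.symm
      | succ i ih =>
        intro hi
        obtain ⟨x, hx⟩ := K.row b (i+1) hb (by omega)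
        have := K.pm_row v b (i+1) hb (by omega) x hx
        rw [hv, if_pos (by omega), if_neg hbh, if_neg (by omega),
          show off γ b + (i+1) - 1 = off γ b + i by omega, ih (by omega)] at this
        simpa [RatFunc.X_ne_zero] using this.symm
  funext y
  obtain ⟨b, i, hb, hi, hy⟩ := off_find γ N y (by rw [K.hq]; exact y.2)
  have := key b hb i hi
  rw [← hy] at this
  simpa [ex] using this

lemma KB.kerA_inj {p q N h : ℕ} {ρ γ : ℕ → ℕ} {A B : Matrix (Fin p) (Fin q) ℂ}
    (K : KB p q N h ρ γ A B) (v : Fin q → ℂ) (hv : A *ᵥ v = 0)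
    (h0 : ∀ b < h, ex v (off γ b + ρ b) = 0) : v = 0 := by
  have key : ∀ b < N, ∀ i < γ b, ex v (off γ b + i) = 0 := by
    intro b hb i hi
    by_cases hir : i < ρ b
    · obtain ⟨x, hx⟩ := K.row b i hb hir
      have h1 := K.hA b hb i hir x hx
      rw [if_pos hi] at h1
      have h2 := congrFun hv x
      change A x ⬝ᵥ v = 0 at h2
      rw [h1] at h2
      rw [← h2]
      exact (ev_dot (RingHom.id ℂ) _ v).symm
    · by_cases hbh : b < h
      · have hL := K.hL b hbh
        rw [show i = ρ b by omega]
        exact h0 b hbh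
      · have hL := K.hLT b (by omega) hb
        omega
  funext y
  obtain ⟨b, i, hb, hi, hy⟩ := off_find γ N y (by rw [K.hq]; exact y.2)
  have := key b hb i hi
  rw [← hy] at this
  simpa [ex] using this

/-- Right null vectors of the block pencil. -/
noncomputable def nul (γ : ℕ → ℕ) (h : ℕ) (u : Fin h → RatFunc ℂ) (y : ℕ) : RatFunc ℂ :=
  ∑ c ∈ Finset.range h, (if off γ c ≤ y ∧ y < off γ c + γ c then
    ex u c * (-RatFunc.X)^(y - off γ c) else 0)

lemma nul_in (γ : ℕ → ℕ) (h : ℕ) (u : Fin h → RatFunc ℂ) (b i : ℕ) (hb : b < h) (hi : i < γ b) :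
    nul γ h u (off γ b + i) = ex u b * (-RatFunc.X)^i := by
  unfold nul
  rw [block_sum γ h b i hb hi, Nat.add_sub_cancel_left]

lemma nul_out (γ : ℕ → ℕ) (h : ℕ) (u : Fin h → RatFunc ℂ) (y : ℕ) (hy : off γ h ≤ y) :
    nul γ h u y = 0 := by
  apply Finset.sum_eq_zero
  intro c hc
  have := off_mono γ (show c + 1 ≤ h from Finset.mem_range.1 hc)
  rw [off_succ] at this
  rw [if_neg (by omega)]

lemma KB.nul_ker {p q N h : ℕ} {ρ γ : ℕ → ℕ} {A B : Matrix (Fin p) (Fin q) ℂ}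
    (K : KB p q N h ρ γ A B) (u : Fin h → RatFunc ℂ) :
    pm A B *ᵥ (fun y : Fin q => nul γ h u y) = 0 := by
  have hoff : off γ h ≤ q := by rw [← K.hq]; exact off_mono γ K.hN
  have hex : ∀ y, ex (fun y : Fin q => nul γ h u y) y = nul γ h u y := by
    intro y
    unfold ex
    split_ifs with hy
    · rfl
    · rw [nul_out]; omega
  funext x
  obtain ⟨b, i, hb, hi, hx⟩ := off_find ρ N x (by rw [K.hp]; exact x.2)
  rw [K.pm_row _ b i hb hi x hx]
  simp only [hex]
  by_cases hbh : b < h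
  · have hL := K.hL b hbh
    rw [if_pos (by omega), if_pos hbh, nul_in γ h u b i hbh (by omega), add_assoc,
      nul_in γ h u b (i+1) hbh (by omega), pow_succ]
    simp only [Pi.zero_apply]
    ring
  · have hm := off_mono γ (show h ≤ b by omega)
    rw [if_neg hbh, nul_out γ h u (off γ b + i) (by omega)]
    by_cases hi0 : i = 0
    · simp [hi0]
    · rw [if_neg hi0, nul_out γ h u _ (by omega)]
      simp

/-- Lift of a vector to the companion pencil. -/
noncomputable def lam (n d : ℕ) : (Fin n → RatFunc ℂ) →ₗ[RatFunc ℂ] (Fin (n*d) → RatFunc ℂ) where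
  toFun x y := RatFunc.X^(d-1-(y:ℕ)/n) * ex x (y%n)
  map_add' x x' := by
    funext y
    simp only [ex, Pi.add_apply]
    split_ifs <;> ring
  map_smul' c x := by
    funext y
    simp only [ex, Pi.smul_apply, smul_eq_mul, RingHom.id_apply]
    split_ifs <;> ring

/-- The last block of a vector. -/
noncomputable def las (n d : ℕ) : (Fin (n*d) → RatFunc ℂ) →ₗ[RatFunc ℂ] (Fin n → RatFunc ℂ) where
  toFun z j := ex z (n*(d-1)+j)
  map_add' x x' := by
    funext y
    simp only [ex, Pi.add_apply]
    split_ifs <;> ring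
  map_smul' c x := by
    funext y
    simp only [ex, Pi.smul_apply, smul_eq_mul, RingHom.id_apply]
    split_ifs <;> ring

lemma las_lam (n d : ℕ) (hn : 0 < n) (hd : 1 ≤ d) (x : Fin n → RatFunc ℂ) :
    las n d (lam n d x) = x := by
  funext j
  have hlt : n*(d-1)+j < n*d := by
    have := j.2
    obtain ⟨D, rfl⟩ : ∃ D, d = D+1 := ⟨d-1, by omega⟩
    rw [Nat.mul_succ, Nat.add_sub_cancel]; omega
  have e1 : (n*(d-1)+(j:ℕ))/n = d-1 := by
    rw [Nat.mul_add_div hn, Nat.div_eq_of_lt j.2, add_zero]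
  have e2 : (n*(d-1)+(j:ℕ))%n = j := by
    rw [Nat.mul_add_mod, Nat.mod_eq_of_lt j.2]
  simp [las, lam, ex, hlt, e1, e2]

lemma pm_bot (m n d : ℕ) (hd : 1 ≤ d) (P : Pol d m n) (z : Fin (n*d) → RatFunc ℂ)
    (t : Fin (n*(d-1))) :
    (pm (compA m n d P) (compB m n d P) *ᵥ z) (Fin.natAdd m t) =
      RatFunc.X * ex z (t+n) - ex z t := by
  rw [pm_mulVec, compA_bot, compB_bot, ev_dot RatFunc.C, sub_eq_add_neg]
  congr 1
  rw [← ev_dot RatFunc.C]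
  simp [dotProduct]

lemma eq_lam (m n d : ℕ) (hn : 0 < n) (hd : 1 ≤ d) (P : Pol d m n) (z : Fin (n*d) → RatFunc ℂ)
    (hz : pm (compA m n d P) (compB m n d P) *ᵥ z = 0) : z = lam n d (las n d z) := by
  have hrec : ∀ t, t < n*(d-1) → ex z t = RatFunc.X * ex z (t+n) := by
    intro t ht
    have := pm_bot m n d hd P z ⟨t, ht⟩
    rw [hz] at this
    exact (sub_eq_zero.1 this.symm).symm
  have key : ∀ k, k < d → ∀ j < n, ex z (n*(d-1-k)+j) = RatFunc.X^k * ex z (n*(d-1)+j) := by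
    intro k
    induction k with
    | zero => intro _ j _; simp
    | succ k ih =>
      intro hk j hj
      have e : n*(d-1-(k+1)) + n = n*(d-1-k) := by
        rw [← Nat.mul_succ]; congr 1; omega
      have e' : n*(d-1-k) ≤ n*(d-1) := Nat.mul_le_mul_left _ (by omega)
      rw [hrec _ (by omega), show n*(d-1-(k+1))+j+n = n*(d-1-k)+j by omega, ih (by omega) j hj,
        pow_succ]
      ring
  funext y
  have hy : (y:ℕ)/n < d := Nat.div_lt_of_lt_mul y.2
  have h0 : 0 ≤ (y:ℕ)/n := Nat.zero_le _
  have := key (d-1-y/n) (by omega) (y%n) (Nat.mod_lt _ hn)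
  rw [show d-1-(d-1-(y:ℕ)/n) = y/n by omega, Nat.div_add_mod] at this
  have e3 : ex z y = z y := by simp [ex]
  rw [← e3, this]
  simp [lam, las, ex, Nat.mod_lt _ hn]

lemma pm_lam_top (m n d : ℕ) (hn : 0 < n) (hd : 1 ≤ d) (P : Pol d m n) (x : Fin n → RatFunc ℂ)
    (i : Fin m) :
    (pm (compA m n d P) (compB m n d P) *ᵥ (lam n d x)) (Fin.castAdd _ i) =
      (ratMatrix P *ᵥ x) i := by
  obtain ⟨D, rfl⟩ : ∃ D, d = D+1 := ⟨d-1, by omega⟩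
  rw [pm_mulVec]
  simp only [dotProduct, Matrix.mulVec, ratMatrix]
  let e : Fin (D+1) × Fin n ≃ Fin (n*(D+1)) :=
    finProdFinEquiv.trans (finCongr (Nat.mul_comm _ _))
  have he : ∀ k j, ((e (k,j) : Fin _) : ℕ) = j + n*k := fun k j => rfl
  have hdiv : ∀ (k : Fin (D+1)) (j : Fin n), ((j:ℕ) + n*k)/n = k := by
    intro k j
    rw [add_comm, Nat.mul_add_div hn, Nat.div_eq_of_lt j.2, add_zero]
  have hmod : ∀ (k : Fin (D+1)) (j : Fin n), ((j:ℕ) + n*k)%n = j := by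
    intro k j
    rw [add_comm, Nat.mul_add_mod, Nat.mod_eq_of_lt j.2]
  have hex : ∀ j : Fin n, ex x j = x j := by intro j; simp [ex]
  have hl : ∀ k j, lam n (D+1) x (e (k,j)) = RatFunc.X^(D-(k:ℕ)) * x j := by
    intro k j
    simp only [lam, LinearMap.coe_mk, AddHom.coe_mk, he, hdiv, hmod, hex, Nat.add_sub_cancel]
  have hA : ∀ k j, compA m n (D+1) P (Fin.castAdd _ i) (e (k,j)) =
      if k = 0 then P (Fin.last _) i j else 0 := by
    intro k j
    have : ((e (k,j) : Fin _) : ℕ) < n ↔ k = 0 := by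
      rw [he]
      constructor
      · intro h
        have := hdiv k j
        rw [Nat.div_eq_of_lt h] at this
        exact Fin.ext this.symm
      · rintro rfl; simp
    simp only [compA, Fin.val_castAdd, i.2, dif_pos, this]
    split_ifs with h
    · subst h
      simp [he]
    · rfl
  have hB : ∀ k j, compB m n (D+1) P (Fin.castAdd _ i) (e (k,j)) = P (Fin.castSucc (Fin.rev k)) i j := by
    intro k j
    simp only [compB, Fin.val_castAdd, i.2, dif_pos, hn, he, hdiv, hmod]
    congr 2
    simp [Fin.val_rev]
  rw [← e.sum_comp, ← e.sum_comp, Fintype.sum_prod_type, Fintype.sum_prod_type, Fin.sum_univ_succ]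
  simp only [hA, hB, hl]
  simp only [Fin.succ_ne_zero, if_false, if_true, map_zero, zero_mul,
    Finset.sum_const_zero, add_zero, Finset.sum_mul]
  rw [Finset.sum_comm, Finset.mul_sum, ← Finset.sum_add_distrib]
  apply Finset.sum_congr rfl
  intro j _
  rw [Fin.sum_univ_castSucc (n := D+1), add_comm]
  congr 1
  · rw [← Equiv.sum_comp Fin.revPerm (fun k : Fin (D+1) => RatFunc.C (P k.castSucc i j) *
      RatFunc.X ^ ((k.castSucc : Fin (D+2)) : ℕ) * x j)]
    apply Finset.sum_congr rfl
    intro k _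
    have : ((Fin.rev k : Fin (D+1)) : ℕ) = D - k := by
      rw [Fin.val_rev]; omega
    simp only [Fin.revPerm_apply, Fin.val_castSucc, this]
    ring
  · simp only [Fin.val_zero, Fin.val_last, Nat.sub_zero, pow_succ]
    ring

lemma pm_lam_bot (m n d : ℕ) (hn : 0 < n) (hd : 1 ≤ d) (P : Pol d m n) (x : Fin n → RatFunc ℂ)
    (t : Fin (n*(d-1))) :
    (pm (compA m n d P) (compB m n d P) *ᵥ (lam n d x)) (Fin.natAdd m t) = 0 := by
  have h1 : (t:ℕ) + n < n*d := idx_lt hd t.2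
  have h2 : (t:ℕ) < n*d := by omega
  have h3 : (t:ℕ)/n < d-1 := Nat.div_lt_of_lt_mul t.2
  have h4 : ((t:ℕ)+n)/n = t/n+1 := Nat.add_div_right _ hn
  have h5 : ((t:ℕ)+n)%n = t%n := Nat.add_mod_right _ _
  have e1 : ex (lam n d x) (t+n) = RatFunc.X^(d-1-((t:ℕ)/n+1)) * ex x (t%n) := by
    rw [ex, dif_pos h1]
    change RatFunc.X^(d-1-((t:ℕ)+n)/n) * ex x (((t:ℕ)+n)%n) = _
    rw [h4, h5]
  have e2 : ex (lam n d x) t = RatFunc.X^(d-1-((t:ℕ)/n)) * ex x (t%n) := by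
    rw [ex, dif_pos h2]
    rfl
  rw [pm_bot m n d hd, e1, e2, show d-1-(t:ℕ)/n = (d-1-((t:ℕ)/n+1)) + 1 by omega, pow_succ]
  ring

lemma lam_ker (m n d : ℕ) (hn : 0 < n) (hd : 1 ≤ d) (P : Pol d m n) (x : Fin n → RatFunc ℂ)
    (hx : ratMatrix P *ᵥ x = 0) : pm (compA m n d P) (compB m n d P) *ᵥ (lam n d x) = 0 := by
  funext k
  refine Fin.addCases (fun i => ?_) (fun t => ?_) k
  · rw [pm_lam_top m n d hn hd, hx]; rfl
  · rw [pm_lam_bot m n d hn hd]; rfl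

lemma las_ker (m n d : ℕ) (hn : 0 < n) (hd : 1 ≤ d) (P : Pol d m n) (z : Fin (n*d) → RatFunc ℂ)
    (hz : pm (compA m n d P) (compB m n d P) *ᵥ z = 0) : ratMatrix P *ᵥ (las n d z) = 0 := by
  funext i
  rw [← pm_lam_top m n d hn hd, ← eq_lam m n d hn hd P z hz, hz]; rfl

/-- Base change of a matrix to rational functions. -/
noncomputable def bc {p q : ℕ} (A : Matrix (Fin p) (Fin q) ℂ) :
    Matrix (Fin p) (Fin q) (RatFunc ℂ) := A.map (RatFunc.C : ℂ →+* RatFunc ℂ)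

lemma bc_mul {p q s : ℕ} (A : Matrix (Fin p) (Fin q) ℂ) (B : Matrix (Fin q) (Fin s) ℂ) :
    bc (A * B) = bc A * bc B := Matrix.map_mul

lemma bc_one {p : ℕ} : bc (1 : Matrix (Fin p) (Fin p) ℂ) = 1 := by
  unfold bc
  exact Matrix.map_one _ (map_zero _) (map_one _)

lemma pm_eq {p q : ℕ} (A B : Matrix (Fin p) (Fin q) ℂ) :
    pm A B = (RatFunc.X : RatFunc ℂ) • bc A + bc B := rfl

lemma pm_mul_right {p q s : ℕ} (A B : Matrix (Fin p) (Fin q) ℂ) (R : Matrix (Fin q) (Fin s) ℂ) :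
    pm (A * R) (B * R) = pm A B * bc R := by
  rw [pm_eq, pm_eq, bc_mul, bc_mul, Matrix.add_mul, Matrix.smul_mul]

lemma pm_mul_left {p q s : ℕ} (A B : Matrix (Fin p) (Fin q) ℂ) (R : Matrix (Fin s) (Fin p) ℂ) :
    pm (R * A) (R * B) = bc R * pm A B := by
  rw [pm_eq, pm_eq, bc_mul, bc_mul, Matrix.mul_add, Matrix.mul_smul]

lemma ex_add {F : Type} [Field F] {q : ℕ} (v w : Fin q → F) (y : ℕ) :
    ex (v + w) y = ex v y + ex w y := by
  unfold ex; split_ifs <;> simp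

lemma ex_smul {F : Type} [Field F] {q : ℕ} (c : F) (v : Fin q → F) (y : ℕ) :
    ex (c • v) y = c * ex v y := by
  unfold ex; split_ifs <;> simp

/-- Sampling of a vector. -/
noncomputable def smp {F : Type} [Field F] {q : ℕ} (h : ℕ) (g : ℕ → ℕ) :
    (Fin q → F) →ₗ[F] (Fin h → F) where
  toFun v b := ex v (g b)
  map_add' v w := by funext b; exact ex_add v w _
  map_smul' c v := by funext b; exact ex_smul c v _

/-- `nul` as a linear map. -/
noncomputable def nulL (γ : ℕ → ℕ) (h q : ℕ) :
    (Fin h → RatFunc ℂ) →ₗ[RatFunc ℂ] (Fin q → RatFunc ℂ) where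
  toFun u y := nul γ h u y
  map_add' u w := by
    funext y
    simp only [nul, ex_add, Pi.add_apply, ← Finset.sum_add_distrib]
    apply Finset.sum_congr rfl
    intro c _
    split_ifs <;> ring
  map_smul' k u := by
    funext y
    simp only [nul, ex_smul, Pi.smul_apply, smul_eq_mul, RingHom.id_apply, Finset.mul_sum]
    apply Finset.sum_congr rfl
    intro c _
    split_ifs <;> ring

lemma rank_main (m n d : ℕ) (hn : 0 < n) (hd : 1 ≤ d) (P : Pol d m n) {N h : ℕ} {ρ γ : ℕ → ℕ}
    {A B : Matrix (Fin (m+n*(d-1))) (Fin (n*d)) ℂ}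
    (K : KB (m+n*(d-1)) (n*d) N h ρ γ A B) (hγ : ∀ b < h, d ≤ γ b)
    (Q Q' : Matrix (Fin (m+n*(d-1))) (Fin (m+n*(d-1))) ℂ) (R R' : Matrix (Fin (n*d)) (Fin (n*d)) ℂ)
    (hQ : Q' * Q = 1) (hR : R * R' = 1) (hR' : R' * R = 1)
    (h1 : compA m n d P * R = Q * A) (h2 : compB m n d P * R = Q * B) :
    nrank P + h = n := by
  have hpm : pm (compA m n d P) (compB m n d P) * bc R = bc Q * pm A B := by
    rw [← pm_mul_right, ← pm_mul_left, h1, h2]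
  have hQb : bc Q' * bc Q = 1 := by rw [← bc_mul, hQ, bc_one]
  have hRb : bc R * bc R' = 1 := by rw [← bc_mul, hR, bc_one]
  have hRb' : bc R' * bc R = 1 := by rw [← bc_mul, hR', bc_one]
  have hpm' : pm A B * bc R' = bc Q' * pm (compA m n d P) (compB m n d P) := by
    calc pm A B * bc R' = (bc Q' * bc Q) * pm A B * bc R' := by rw [hQb, Matrix.one_mul]
      _ = bc Q' * (bc Q * pm A B) * bc R' := by rw [Matrix.mul_assoc (bc Q')]
      _ = bc Q' * pm (compA m n d P) (compB m n d P) * (bc R * bc R') := by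
        rw [← hpm]; simp only [Matrix.mul_assoc]
      _ = _ := by rw [hRb, Matrix.mul_one]
  have hrk := LinearMap.finrank_range_add_finrank_ker (ratMatrix P).mulVecLin
  rw [Module.finrank_fin_fun] at hrk
  have hle : Module.finrank (RatFunc ℂ) (LinearMap.ker (ratMatrix P).mulVecLin) ≤ h := by
    let f : LinearMap.ker (ratMatrix P).mulVecLin →ₗ[RatFunc ℂ] (Fin h → RatFunc ℂ) :=
      (smp h (off γ)) ∘ₗ (bc R').mulVecLin ∘ₗ (lam n d) ∘ₗ (Submodule.subtype _)
    have hf : Function.Injective f := by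
      rw [← LinearMap.ker_eq_bot, LinearMap.ker_eq_bot']
      rintro ⟨x, hx⟩ hfx
      have hx' : ratMatrix P *ᵥ x = 0 := hx
      have hl := lam_ker m n d hn hd P x hx'
      have hv : pm A B *ᵥ (bc R' *ᵥ lam n d x) = 0 := by
        rw [Matrix.mulVec_mulVec, hpm', ← Matrix.mulVec_mulVec, hl, Matrix.mulVec_zero]
      have h0 := K.ker_inj _ hv (fun b hb => congrFun hfx ⟨b, hb⟩)
      have h3 : lam n d x = 0 := by
        have := congrArg (fun w => bc R *ᵥ w) h0
        simpa [Matrix.mulVec_mulVec, hRb] using this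
      have h4 := las_lam n d hn hd x
      rw [h3, map_zero] at h4
      exact Subtype.ext h4.symm
    have := LinearMap.finrank_le_finrank_of_injective hf
    rwa [Module.finrank_fin_fun] at this
  have hge : h ≤ Module.finrank (RatFunc ℂ) (LinearMap.ker (ratMatrix P).mulVecLin) := by
    have hker : ∀ u, pm (compA m n d P) (compB m n d P) *ᵥ (bc R *ᵥ nulL γ h (n*d) u) = 0 := by
      intro u
      rw [Matrix.mulVec_mulVec, hpm, ← Matrix.mulVec_mulVec]
      have := K.nul_ker u
      change bc Q *ᵥ (pm A B *ᵥ (fun y : Fin (n*d) => nul γ h u y)) = 0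
      rw [this, Matrix.mulVec_zero]
    let g : (Fin h → RatFunc ℂ) →ₗ[RatFunc ℂ] LinearMap.ker (ratMatrix P).mulVecLin :=
      LinearMap.codRestrict _ ((las n d) ∘ₗ (bc R).mulVecLin ∘ₗ nulL γ h (n*d))
        (fun u => las_ker m n d hn hd P _ (hker u))
    have hg : Function.Injective g := by
      rw [← LinearMap.ker_eq_bot, LinearMap.ker_eq_bot']
      intro u hu
      have h3 : las n d (bc R *ᵥ nulL γ h (n*d) u) = 0 := congrArg Subtype.val hu
      have h4 := eq_lam m n d hn hd P _ (hker u)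
      rw [h3, map_zero] at h4
      have h5 : nulL γ h (n*d) u = 0 := by
        have := congrArg (fun w => bc R' *ᵥ w) h4
        simpa [Matrix.mulVec_mulVec, hRb'] using this
      funext b
      have hb := hγ b b.2
      have hoff : off γ b + γ b ≤ n*d := by
        have := off_mono γ (show (b:ℕ)+1 ≤ N from b.2.trans_le K.hN)
        rw [K.hq, off_succ] at this
        exact this
      have h6 := congrFun h5 ⟨off γ b + 0, by omega⟩
      change nul γ h u (off γ b + 0) = 0 at h6
      rw [nul_in γ h u b 0 b.2 (by omega)] at h6
      simpa [ex] using h6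
    have := LinearMap.finrank_le_finrank_of_injective hg
    rwa [Module.finrank_fin_fun] at this
  have : nrank P = Module.finrank (RatFunc ℂ) (LinearMap.range (ratMatrix P).mulVecLin) := rfl
  omega

/-- Extension by zero as a linear map. -/
noncomputable def exL (n q : ℕ) : (Fin n → ℂ) →ₗ[ℂ] (Fin q → ℂ) where
  toFun x y := ex x y
  map_add' v w := by funext b; exact ex_add v w _
  map_smul' c v := by funext b; exact ex_smul c v _

lemma lead_main (m n d : ℕ) (hn : 0 < n) (hd : 1 ≤ d) (P : Pol d m n) {N h : ℕ} {ρ γ : ℕ → ℕ}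
    {A B : Matrix (Fin (m+n*(d-1))) (Fin (n*d)) ℂ}
    (K : KB (m+n*(d-1)) (n*d) N h ρ γ A B) (hh : h < n)
    (Q Q' : Matrix (Fin (m+n*(d-1))) (Fin (m+n*(d-1))) ℂ) (R R' : Matrix (Fin (n*d)) (Fin (n*d)) ℂ)
    (hQ : Q' * Q = 1) (hR : R * R' = 1)
    (h1 : compA m n d P * R = Q * A) : P (Fin.last d) ≠ 0 := by
  intro hP
  have hA : A * R' = Q' * compA m n d P := by
    calc A * R' = (Q' * Q) * A * R' := by rw [hQ, Matrix.one_mul]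
      _ = Q' * (Q * A) * R' := by rw [Matrix.mul_assoc Q']
      _ = Q' * compA m n d P * (R * R') := by rw [← h1]; simp only [Matrix.mul_assoc]
      _ = _ := by rw [hR, Matrix.mul_one]
  have hnd : n ≤ n*d := Nat.le_mul_of_pos_right n hd
  have hk : ∀ x, compA m n d P *ᵥ exL n (n*d) x = 0 := by
    intro x
    funext k
    change ∑ y, compA m n d P k y * exL n (n*d) x y = 0
    apply Finset.sum_eq_zero
    intro y _
    simp only [compA, hP]
    change _ * ex x y = 0
    by_cases hy : (y:ℕ) < n
    · have : ¬ (n ≤ (y:ℕ)) := by omega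
      simp [this]
    · simp [ex, hy]
  let f : (Fin n → ℂ) →ₗ[ℂ] (Fin h → ℂ) :=
    (smp h (fun b => off γ b + ρ b)) ∘ₗ R'.mulVecLin ∘ₗ exL n (n*d)
  have hf : Function.Injective f := by
    rw [← LinearMap.ker_eq_bot, LinearMap.ker_eq_bot']
    intro x hx
    have hv : A *ᵥ (R' *ᵥ exL n (n*d) x) = 0 := by
      rw [Matrix.mulVec_mulVec, hA, ← Matrix.mulVec_mulVec, hk, Matrix.mulVec_zero]
    have h0 := K.kerA_inj _ hv (fun b hb => congrFun hx ⟨b, hb⟩)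
    have h3 : exL n (n*d) x = 0 := by
      have := congrArg (fun w => R *ᵥ w) h0
      simpa [Matrix.mulVec_mulVec, hR] using this
    funext j
    have h4 := congrFun h3 ⟨j, j.2.trans_le hnd⟩
    change ex x j = 0 at h4
    simpa [ex] using h4
  have := LinearMap.finrank_le_finrank_of_injective hf
  rw [Module.finrank_fin_fun, Module.finrank_fin_fun] at this
  omega

/-- There is a matrix polynomial of degree exactly `d` and normal rank
exactly `r` whose first companion form is strictly equivalent to the pencil `G_a`. -/
theorem exists_poly_with_Ga_eigenstructure (m n d r a : ℕ) (hm : 2 ≤ m) (hn : 2 ≤ n)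
    (hd : 1 ≤ d) (hr1 : 1 ≤ r) (hr2 : r ≤ min m n - 1) (ha : a ≤ r * d) :
    ∃ P : Pol d m n, P (Fin.last d) ≠ 0 ∧ nrank P = r ∧
      StrictEquiv (comp m n d P) (Ga m n d r a) := by
  have hrm : r < m := by omega
  have hrn : r < n := by omega
  have hn0 : 0 < n := by omega
  obtain ⟨N, ρ, γ, K, hγ⟩ := Ga_KB m n d r a hd hrm hrn ha
  obtain ⟨R, hR, hRow⟩ := exists_R n d _ hn0 hd _ _ (K.chains d hd hγ)
  obtain ⟨P, Q, hQ, h1, h2⟩ := exists_comp m n d hn0 hd _ _ R hR hRow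
  have hQd := (Matrix.isUnit_iff_isUnit_det Q).1 hQ
  have hRd := (Matrix.isUnit_iff_isUnit_det R).1 hR
  have hQ1 := Matrix.nonsing_inv_mul Q hQd
  have hR1 := Matrix.mul_nonsing_inv R hRd
  have hR2 := Matrix.nonsing_inv_mul R hRd
  refine ⟨P, lead_main m n d hn0 hd P K (by omega) Q Q⁻¹ R R⁻¹ hQ1 hR1 h1, ?_,
    Q, R, hQ, hR, ?_, ?_⟩
  · have := rank_main m n d hn0 hd P K hγ Q Q⁻¹ R R⁻¹ hQ1 hR1 hR2 h1 h2
    omega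
  · change Q⁻¹ * compA m n d P * R = _
    rw [Matrix.mul_assoc, h1, ← Matrix.mul_assoc, hQ1, Matrix.one_mul]
  · change Q⁻¹ * compB m n d P * R = _
    rw [Matrix.mul_assoc, h2, ← Matrix.mul_assoc, hQ1, Matrix.one_mul]

end MPoly
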